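/- There exist an approval-based committee voting instance and a fractional committee p such that p satisfies Strong UFS but does not satisfy GFS. Concretely: n = 3 voters, C = {c_1, …, c_5}, k = 2, A_1 = {c_1, c_2}, A_2 = {c_1, c_3}, A_3 = {c_4, c_5}, and p = (2/3, 0, 0, 1, 1/3). -/

import Mathlib

open Finset

namespace BWCV

variable {n m : ℕ}

/-- Utility of voter `i` for a fractional committee `p`. -/
def utility (A : Fin n → Finset (Fin m)) (p : Fin m → ℝ) (i : Fin n) : ℝ :=
  ∑ c ∈ A i, p c

/-- `p` is a fractional committee of size `k`. -/
def IsFractionalCommittee (k : ℕ) (p : Fin m → ℝ) : Prop :=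
  (∀ c, 0 ≤ p c ∧ p c ≤ 1) ∧ ∑ c, p c = (k : ℝ)

/-- Group Fair Share. -/
def GFS (k : ℕ) (A : Fin n → Finset (Fin m)) (p : Fin m → ℝ) : Prop :=
  ∀ S : Finset (Fin n),
    (1 / (n : ℝ)) * ∑ i ∈ S, ((min k (A i).card : ℕ) : ℝ) ≤ ∑ c ∈ S.biUnion A, p c

/-- Unanimous Fair Share. -/
def UFS (k : ℕ) (A : Fin n → Finset (Fin m)) (p : Fin m → ℝ) : Prop :=
  ∀ S : Finset (Fin n), (∀ i ∈ S, ∀ j ∈ S, A i = A j) →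
    ∀ i ∈ S, ((S.card : ℝ) / n) * ((min k (A i).card : ℕ) : ℝ) ≤ utility A p i

/-- Strong Unanimous Fair Share. -/
def StrongUFS (k : ℕ) (A : Fin n → Finset (Fin m)) (p : Fin m → ℝ) : Prop :=
  ∀ S : Finset (Fin n), (∀ i ∈ S, ∀ j ∈ S, A i = A j) →
    ∀ i ∈ S, min ((S.card : ℝ) * k / n) ((A i).card : ℝ) ≤ utility A p i

/-- Individual Fair Share. -/
def IFS (k : ℕ) (A : Fin n → Finset (Fin m)) (p : Fin m → ℝ) : Prop :=
  ∀ i, (1 / (n : ℝ)) * ((min k (A i).card : ℕ) : ℝ) ≤ utility A p i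

/-- Strong Individual Fair Share. -/
def StrongIFS (k : ℕ) (A : Fin n → Finset (Fin m)) (p : Fin m → ℝ) : Prop :=
  ∀ i, min ((k : ℝ) / n) ((A i).card : ℝ) ≤ utility A p i

/-- An `ℓ`-cohesive group of voters: `|N'| ≥ ℓ·n/k` and the voters in `N'`
commonly approve at least `ℓ` candidates. -/
def Cohesive (k : ℕ) (A : Fin n → Finset (Fin m)) (ℓ : ℕ) (N' : Finset (Fin n)) : Prop :=
  ((ℓ : ℝ) * n / k ≤ (N'.card : ℝ)) ∧ ℓ ≤ (N'.inf A).card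

/-- Justified Representation. -/
def JR (k : ℕ) (A : Fin n → Finset (Fin m)) (W : Finset (Fin m)) : Prop :=
  ∀ N' : Finset (Fin n), Cohesive k A 1 N' → ∃ i ∈ N', (A i ∩ W).Nonempty

/-- Proportional Justified Representation. -/
def PJR (k : ℕ) (A : Fin n → Finset (Fin m)) (W : Finset (Fin m)) : Prop :=
  ∀ ℓ : ℕ, 0 < ℓ → ∀ N' : Finset (Fin n), Cohesive k A ℓ N' →
    ℓ ≤ ((N'.biUnion A) ∩ W).card

/-- Extended Justified Representation. -/
def EJR (k : ℕ) (A : Fin n → Finset (Fin m)) (W : Finset (Fin m)) : Prop :=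
  ∀ ℓ : ℕ, 0 < ℓ → ∀ N' : Finset (Fin n), Cohesive k A ℓ N' →
    ∃ i ∈ N', ℓ ≤ (A i ∩ W).card

/-- EJR+. -/
def EJRplus (k : ℕ) (A : Fin n → Finset (Fin m)) (W : Finset (Fin m)) : Prop :=
  ¬ ∃ (c : Fin m) (N' : Finset (Fin n)) (ℓ : ℕ), c ∉ W ∧ 0 < ℓ ∧
      ((ℓ : ℝ) * n / k ≤ (N'.card : ℝ)) ∧ (∀ i ∈ N', c ∈ A i) ∧
      (∀ i ∈ N', (A i ∩ W).card < ℓ)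

/-- A weakly `(β, T)`-cohesive group of voters. -/
def WeaklyCohesive (k : ℕ) (A : Fin n → Finset (Fin m)) (β : ℕ) (T : Finset (Fin m))
    (N' : Finset (Fin n)) : Prop :=
  ((T.card : ℝ) * n / k ≤ (N'.card : ℝ)) ∧ ∀ i ∈ N', β ≤ (A i ∩ T).card

/-- Fully Justified Representation. -/
def FJR (k : ℕ) (A : Fin n → Finset (Fin m)) (W : Finset (Fin m)) : Prop :=
  ∀ β : ℕ, 0 < β → ∀ T : Finset (Fin m), ∀ N' : Finset (Fin n),
    WeaklyCohesive k A β T N' → ∃ i ∈ N', β ≤ (A i ∩ W).card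

/-- The randomized committee `(lam, W)` implements the fractional committee `p`. -/
def Implements {s : ℕ} (lam : Fin s → ℝ) (W : Fin s → Finset (Fin m)) (p : Fin m → ℝ) : Prop :=
  ∀ c, p c = ∑ j, lam j * (if c ∈ W j then 1 else 0)

def A₁₄ : Fin 3 → Finset (Fin 5) := ![{0, 1}, {0, 2}, {3, 4}]

noncomputable def p₁₄ : Fin 5 → ℝ := ![2 / 3, 0, 0, 1, 1 / 3]

lemma A₁₄_injective : Function.Injective A₁₄ := by
  unfold A₁₄
  decide

lemma two_thirds_le_utility (i : Fin 3) : 2 / 3 ≤ utility A₁₄ p₁₄ i := by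
  fin_cases i
  · change 2 / 3 ≤ ∑ c ∈ ({0, 1} : Finset (Fin 5)), p₁₄ c
    rw [Finset.sum_pair (by decide)]
    simp [p₁₄]
  · change 2 / 3 ≤ ∑ c ∈ ({0, 2} : Finset (Fin 5)), p₁₄ c
    rw [Finset.sum_pair (by decide)]
    simp [p₁₄]
  · change 2 / 3 ≤ ∑ c ∈ ({3, 4} : Finset (Fin 5)), p₁₄ c
    rw [Finset.sum_pair (by decide), show p₁₄ 3 = 1 from rfl, show p₁₄ 4 = 1 / 3 from rfl]
    norm_num

theorem StrongUFS_not_implies_GFS :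
    StrongUFS 2 A₁₄ p₁₄ ∧ ¬ GFS 2 A₁₄ p₁₄ := by
  constructor
  · intro S hS i hi
    have hcard : (S.card : ℝ) ≤ 1 := by
      exact_mod_cast Finset.card_le_one.mpr fun a ha b hb => A₁₄_injective (hS a ha b hb)
    refine (min_le_left _ _).trans (le_trans ?_ (two_thirds_le_utility i))
    push_cast
    linarith
  · intro h
    have hunion : ({0, 1} : Finset (Fin 3)).biUnion A₁₄ = {0, 1, 2} := by
      unfold A₁₄
      decide
    have hcard : ∀ i ∈ ({0, 1} : Finset (Fin 3)), min 2 (A₁₄ i).card = 2 := by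
      unfold A₁₄
      decide
    have hdemand : ∑ i ∈ ({0, 1} : Finset (Fin 3)), ((min 2 (A₁₄ i).card : ℕ) : ℝ) = 4 := by
      rw [Finset.sum_congr rfl fun i hi => congrArg Nat.cast (hcard i hi)]
      norm_num
    have hsupply : ∑ c ∈ ({0, 1, 2} : Finset (Fin 5)), p₁₄ c = 2 / 3 := by
      rw [Finset.sum_insert (by decide), Finset.sum_pair (by decide)]
      simp [p₁₄]
    have hGFS := h {0, 1}
    rw [hunion, hdemand, hsupply] at hGFS
    norm_num at hGFS

end BWCV
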